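/- Let μ > 0 and let W_vol : (0,∞) → ℝ be a C² function with W_vol(t) = 0 if and only if t = 1, W_vol(t) → +∞ as t → 0⁺, W_vol(t) ≥ k t² for all t ≥ M for some constants M, k > 0, and W_vol''(1) > 0. Fix a unit vector n ∈ ℝ³ and define, for ε > 0 and symmetric E ∈ ℝ^{3×3}, q_{n,ε}(E) := (1/ε²)·[ (μ/2)( tr((I+εE)ᵀ L_{n,ε}^{−1} (I+εE))/(det(I+εE))^{2/3} − 3 ) + W_vol(det(I+εE)) ], where L_{n,ε} := (1+ε)² n⊗n + (1+ε)^{−1}(I − n⊗n) (this is well defined for ε small, since then det(I+εE) > 0). Define V_n(E) := ( (1/2)W_vol''(1) − μ/3 )·tr²(E − U_n) + μ‖E − U_n‖², where U_n := (1/2)(3 n⊗n − I). Then q_{n,ε} → V_n as ε → 0⁺, uniformly on every compact subset of the 3×3 real symmetric matrices. -/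

import Mathlib

open Matrix Filter Topology

noncomputable section

/-- Frobenius norm of a real `3 × 3` matrix. -/
def frob (F : Matrix (Fin 3) (Fin 3) ℝ) : ℝ :=
  Real.sqrt (∑ i, ∑ j, (F i j) ^ 2)

/-- `L_{n,ε} = (1+ε)² n⊗n + (1+ε)⁻¹ (I - n⊗n)`. -/
def Lne (ε : ℝ) (n : Fin 3 → ℝ) : Matrix (Fin 3) (Fin 3) ℝ :=
  (1 + ε) ^ 2 • Matrix.vecMulVec n n + (1 + ε)⁻¹ • (1 - Matrix.vecMulVec n n)

/-- `U_n = (1/2)(3 n⊗n − I)`. -/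
def Un (n : Fin 3 → ℝ) : Matrix (Fin 3) (Fin 3) ℝ :=
  (1 / 2 : ℝ) • ((3 : ℝ) • Matrix.vecMulVec n n - 1)

/-- The conditions on the volumetric energy `W_vol`. -/
structure WvolHyp (Wvol : ℝ → ℝ) : Prop where
  c2 : ContDiffOn ℝ 2 Wvol (Set.Ioi (0 : ℝ))
  zero_iff : ∀ t : ℝ, 0 < t → (Wvol t = 0 ↔ t = 1)
  tendsto_top : Tendsto Wvol (𝓝[>] (0 : ℝ)) atTop
  quad_growth : ∃ M > (0 : ℝ), ∃ k > (0 : ℝ), ∀ t : ℝ, M ≤ t → k * t ^ 2 ≤ Wvol t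
  second_deriv_pos : 0 < deriv (deriv Wvol) 1

/-- The rescaled energy `q_{n,ε}(E) = (1/ε²) W_{n,ε}(I + εE)`. -/
def qne (μ : ℝ) (Wvol : ℝ → ℝ) (n : Fin 3 → ℝ) (ε : ℝ)
    (E : Matrix (Fin 3) (Fin 3) ℝ) : ℝ :=
  1 / ε ^ 2 *
    (μ / 2 * (Matrix.trace ((1 + ε • E)ᵀ * (Lne ε n)⁻¹ * (1 + ε • E)) /
        (1 + ε • E).det ^ ((2 : ℝ) / 3) - 3)
      + Wvol (1 + ε • E).det)

/-- `V_n(E) = ((1/2)W_vol''(1) − μ/3) tr²(E − U_n) + μ‖E − U_n‖²`. -/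
def Vn (μ wpp : ℝ) (n : Fin 3 → ℝ) (E : Matrix (Fin 3) (Fin 3) ℝ) : ℝ :=
  (1 / 2 * wpp - μ / 3) * (Matrix.trace (E - Un n)) ^ 2 + μ * (frob (E - Un n)) ^ 2

lemma Lne_inv {ε : ℝ} (hε : 1 + ε ≠ 0) {n : Fin 3 → ℝ} (hn : ∑ i, (n i) ^ 2 = 1) :
    (Lne ε n)⁻¹ =
      ((1 + ε) ^ 2)⁻¹ • vecMulVec n n + (1 + ε) • (1 - vecMulVec n n) := by
  have hN : vecMulVec n n * vecMulVec n n = vecMulVec n n := by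
    have h : n ⬝ᵥ n = 1 := by
      rw [← hn]
      exact Finset.sum_congr rfl fun i _ => (sq (n i)).symm
    rw [vecMulVec_mul_vecMulVec, h, one_smul]
  apply Matrix.inv_eq_right_inv
  unfold Lne
  generalize vecMulVec n n = N at hN
  have hprod : ∀ a b α β : ℝ, (a • N + b • (1 - N)) * (α • N + β • (1 - N)) =
      (a * α) • N + (b * β) • (1 - N) := by
    intro a b α β
    simp [add_mul, mul_add, mul_sub, sub_mul, hN, smul_smul, mul_comm α, mul_comm β]
  rw [hprod, mul_inv_cancel₀ (pow_ne_zero 2 hε), inv_mul_cancel₀ hε]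
  simp

lemma det_one_add_smul_fin_three (ε : ℝ) (E : Matrix (Fin 3) (Fin 3) ℝ) :
    (1 + ε • E).det =
      1 + ε * (E.trace + ε * ((E.trace ^ 2 - (E * E).trace) / 2) + ε ^ 2 * E.det) := by
  simp [det_fin_three, trace, Fin.sum_univ_three, mul_apply]
  ring

/-- The trace of `FᵀL⁻¹F` expanded to second order in `ε`, for `F = I + εE`. -/
lemma trace_Lne_inv {ε : ℝ} (hε : 1 + ε ≠ 0) {n : Fin 3 → ℝ} (hn : ∑ i, (n i) ^ 2 = 1)
    (E : Matrix (Fin 3) (Fin 3) ℝ) :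
    trace ((1 + ε • E)ᵀ * (Lne ε n)⁻¹ * (1 + ε • E)) =
      3 + 2 * E.trace * ε + ε ^ 2 *
        ((3 + 2 * ε) / (1 + ε) ^ 2 *
            (1 + 2 * ε * (n ⬝ᵥ E *ᵥ n) + ε ^ 2 * (n ᵥ* E ⬝ᵥ n ᵥ* E))
          - 4 * (n ⬝ᵥ E *ᵥ n) + (n ᵥ* E ⬝ᵥ n ᵥ* E) - 2 * ε * (n ᵥ* E ⬝ᵥ n ᵥ* E)
          + 2 * (E.trace - n ⬝ᵥ E *ᵥ n)
          + (∑ i, ∑ j, (E i j) ^ 2 - n ᵥ* E ⬝ᵥ n ᵥ* E) * (1 + ε)) := by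
  have key : ∀ (α β : ℝ) (F : Matrix (Fin 3) (Fin 3) ℝ),
      trace (Fᵀ * (α • vecMulVec n n + β • (1 - vecMulVec n n)) * F) =
        α * (n ᵥ* F ⬝ᵥ n ᵥ* F) + β * (∑ i, ∑ j, (F i j) ^ 2 - n ᵥ* F ⬝ᵥ n ᵥ* F) := by
    intro α β F
    simp [trace, Fin.sum_univ_three, mul_apply, vecMulVec_apply, vecMul, dotProduct]
    ring
  have hnF : n ᵥ* (1 + ε • E) ⬝ᵥ n ᵥ* (1 + ε • E) =
      1 + 2 * ε * (n ⬝ᵥ E *ᵥ n) + ε ^ 2 * (n ᵥ* E ⬝ᵥ n ᵥ* E) := by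
    simp [Fin.sum_univ_three, vecMul, mulVec, dotProduct, one_apply] at hn ⊢
    linear_combination hn
  have hF : ∑ i, ∑ j, ((1 + ε • E) i j) ^ 2 =
      3 + 2 * ε * E.trace + ε ^ 2 * ∑ i, ∑ j, (E i j) ^ 2 := by
    simp [Fin.sum_univ_three, trace, one_apply]
    ring
  rw [Lne_inv hε hn, key, hnF, hF]
  field_simp
  ring

lemma frob_sq (F : Matrix (Fin 3) (Fin 3) ℝ) : frob F ^ 2 = ∑ i, ∑ j, (F i j) ^ 2 :=
  Real.sq_sqrt (Finset.sum_nonneg fun _ _ => Finset.sum_nonneg fun _ _ => sq_nonneg _)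

lemma Vn_eq (μ w : ℝ) {n : Fin 3 → ℝ} (hn : ∑ i, (n i) ^ 2 = 1)
    (E : Matrix (Fin 3) (Fin 3) ℝ) :
    Vn μ w n E = (1 / 2 * w - μ / 3) * E.trace ^ 2 +
      μ * (∑ i, ∑ j, (E i j) ^ 2 - 3 * (n ⬝ᵥ E *ᵥ n) + E.trace + 3 / 2) := by
  have htr : (E - Un n).trace = E.trace := by
    simp [Un, trace, Fin.sum_univ_three, vecMulVec_apply] at hn ⊢
    linear_combination (3 / 2) * hn
  have hfrob : frob (E - Un n) ^ 2 =
      ∑ i, ∑ j, (E i j) ^ 2 - 3 * (n ⬝ᵥ E *ᵥ n) + E.trace + 3 / 2 := by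
    rw [frob_sq]
    simp [Un, trace, Fin.sum_univ_three, vecMulVec_apply, mulVec, dotProduct, one_apply] at hn ⊢
    linear_combination (9 / 4 * (n 0 ^ 2 + n 1 ^ 2 + n 2 ^ 2 + 1) - 3 / 2) * hn
  rw [Vn, htr, hfrob]

/-- Second-order Peano expansion at `1`, with the remainder absorbed in the coefficient. -/
lemma exists_second_order_expansion {f : ℝ → ℝ} (hf : ContDiffOn ℝ 2 f (Set.Ioi 0)) :
    ∃ g : ℝ → ℝ, Tendsto g (𝓝 0) (𝓝 (deriv (deriv f) 1 / 2)) ∧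
      ∀ h, f (1 + h) = f 1 + deriv f 1 * h + g h * h ^ 2 := by
  have hT : ∀ x, taylorWithinEval f 2 (Set.Ioi 0) 1 x =
      f 1 + deriv f 1 * (x - 1) + deriv (deriv f) 1 / 2 * (x - 1) ^ 2 := by
    intro x
    have h1 : iteratedDerivWithin 1 f (Set.Ioi 0) 1 = deriv f 1 := by
      rw [iteratedDerivWithin_of_isOpen isOpen_Ioi (Set.mem_Ioi.2 one_pos), iteratedDeriv_one]
    have h2 : iteratedDerivWithin 2 f (Set.Ioi 0) 1 = deriv (deriv f) 1 := by
      rw [iteratedDerivWithin_of_isOpen isOpen_Ioi (Set.mem_Ioi.2 one_pos), iteratedDeriv_succ,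
        iteratedDeriv_one]
    simp [taylorWithinEval_succ, h1, h2]
    ring
  have hlim := taylor_tendsto (convex_Ioi (0 : ℝ)) (Set.mem_Ioi.2 one_pos) hf
  rw [isOpen_Ioi.nhdsWithin_eq (Set.mem_Ioi.2 one_pos)] at hlim
  have hshift : Tendsto (fun h : ℝ => 1 + h) (𝓝 0) (𝓝 1) := by
    simpa using (continuous_const.add continuous_id).tendsto (0 : ℝ) (f := fun h : ℝ => 1 + h)
  refine ⟨fun h => deriv (deriv f) 1 / 2 +
    ((1 + h - 1) ^ 2)⁻¹ • (f (1 + h) - taylorWithinEval f 2 (Set.Ioi 0) 1 (1 + h)), ?_, ?_⟩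
  · simpa using (hlim.comp hshift).const_add (deriv (deriv f) 1 / 2)
  · intro h
    rcases eq_or_ne h 0 with rfl | hh
    · simp
    · simp only [hT, smul_eq_mul, add_sub_cancel_left]
      field_simp
      ring

lemma WvolHyp.deriv_one {Wvol : ℝ → ℝ} (hW : WvolHyp Wvol) : deriv Wvol 1 = 0 := by
  have hcont : ContinuousOn Wvol (Set.Ioi 0) := hW.c2.continuousOn
  have hW1 : Wvol 1 = 0 := (hW.zero_iff 1 one_pos).2 rfl
  have hnonneg : ∀ t, 0 < t → 0 ≤ Wvol t := by
    intro t ht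
    by_contra! hneg
    rcases lt_trichotomy t 1 with h1 | rfl | h1
    · obtain ⟨s, hs, hs0, hst⟩ := ((hW.tendsto_top.eventually_ge_atTop 0).and
        (Ioo_mem_nhdsGT ht)).exists
      obtain ⟨r, hr, hr0⟩ := intermediate_value_Icc' hst.le
        (hcont.mono fun x hx => hs0.trans_le hx.1) ⟨hneg.le, hs⟩
      exact absurd ((hW.zero_iff r (hs0.trans_le hr.1)).1 hr0) (hr.2.trans_lt h1).ne
    · exact hneg.ne hW1
    · obtain ⟨M, hM, k, hk, hgrowth⟩ := hW.quad_growth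
      have hmax : 0 ≤ Wvol (max t M) :=
        (by positivity : (0 : ℝ) ≤ k * max t M ^ 2).trans (hgrowth _ (le_max_right _ _))
      obtain ⟨r, hr, hr0⟩ := intermediate_value_Icc (le_max_left t M)
        (hcont.mono fun x hx => ht.trans_le hx.1) ⟨hneg.le, hmax⟩
      exact absurd ((hW.zero_iff r (ht.trans_le hr.1)).1 hr0) (h1.trans_le hr.1).ne'
  have hmin : IsLocalMin Wvol 1 := by
    filter_upwards [Ioi_mem_nhds one_pos] with t ht
    rw [hW1]
    exact hnonneg t ht
  exact hmin.deriv_eq_zero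

lemma tendsto_qne {μ : ℝ} {Wvol : ℝ → ℝ} (hW : WvolHyp Wvol)
    {n : Fin 3 → ℝ} (hn : ∑ i, (n i) ^ 2 = 1) {E₀ : Matrix (Fin 3) (Fin 3) ℝ}
    (hE₀ : E₀.IsSymm) :
    Tendsto (fun p : ℝ × Matrix (Fin 3) (Fin 3) ℝ => qne μ Wvol n p.1 p.2)
      (𝓝[>] 0 ×ˢ 𝓝 E₀) (𝓝 (Vn μ (deriv (deriv Wvol) 1) n E₀)) := by
  obtain ⟨g, hg, hgW⟩ := exists_second_order_expansion hW.c2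
  have hrpow : ContDiffOn ℝ 2 (fun x : ℝ => x ^ (-(2 / 3) : ℝ)) (Set.Ioi 0) :=
    fun x hx => (Real.contDiffAt_rpow_const_of_ne (ne_of_gt hx)).contDiffWithinAt
  obtain ⟨ψ, hψ, hψr⟩ := exists_second_order_expansion hrpow
  have hd : deriv (fun x : ℝ => x ^ (-(2 / 3) : ℝ)) = fun x => -(2 / 3) * x ^ (-(5 / 3) : ℝ) := by
    rw [Real.deriv_rpow_const']
    norm_num
  have hdd : deriv (deriv fun x : ℝ => x ^ (-(2 / 3) : ℝ)) 1 = 10 / 9 := by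
    rw [hd, deriv_const_mul_field, Real.deriv_rpow_const]
    norm_num
  rw [hdd] at hψ
  simp only [hd, Real.one_rpow, mul_one] at hψr
  simp only [hW.deriv_one, (hW.zero_iff 1 one_pos).2 rfl, zero_mul, zero_add] at hgW
  set l := 𝓝[>] (0 : ℝ) ×ˢ 𝓝 E₀
  have hl : l ≤ 𝓝 (0, E₀) := by
    rw [nhds_prod_eq]
    exact Filter.prod_mono nhdsWithin_le_nhds le_rfl
  set c : ℝ × Matrix (Fin 3) (Fin 3) ℝ → ℝ := fun p => p.2.trace +
    p.1 * ((p.2.trace ^ 2 - (p.2 * p.2).trace) / 2) + p.1 ^ 2 * p.2.det with hc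
  have hc_cont : Continuous c := by fun_prop
  have hc_lim : Tendsto c l (𝓝 E₀.trace) := by
    simpa [hc] using (hc_cont.tendsto (0, E₀)).mono_left hl
  have hh_lim : Tendsto (fun p => p.1 * c p) l (𝓝 0) := by
    have hcont : Continuous fun p => p.1 * c p := continuous_fst.mul hc_cont
    simpa using (hcont.tendsto (0, E₀)).mono_left hl
  set B : ℝ × Matrix (Fin 3) (Fin 3) ℝ → ℝ := fun p =>
    (3 + 2 * p.1) / (1 + p.1) ^ 2 *
        (1 + 2 * p.1 * (n ⬝ᵥ p.2 *ᵥ n) + p.1 ^ 2 * (n ᵥ* p.2 ⬝ᵥ n ᵥ* p.2))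
      - 4 * (n ⬝ᵥ p.2 *ᵥ n) + (n ᵥ* p.2 ⬝ᵥ n ᵥ* p.2) - 2 * p.1 * (n ᵥ* p.2 ⬝ᵥ n ᵥ* p.2)
      + 2 * (p.2.trace - n ⬝ᵥ p.2 *ᵥ n)
      + (∑ i, ∑ j, (p.2 i j) ^ 2 - n ᵥ* p.2 ⬝ᵥ n ᵥ* p.2) * (1 + p.1) with hB
  have hB_lim : Tendsto B l
      (𝓝 (3 - 6 * (n ⬝ᵥ E₀ *ᵥ n) + 2 * E₀.trace + ∑ i, ∑ j, (E₀ i j) ^ 2)) := by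
    have hcont : ContinuousAt B (0, E₀) := by
      have hne : (1 + (0 : ℝ)) ^ 2 ≠ 0 := by norm_num
      fun_prop (disch := exact hne)
    have hB0 : B (0, E₀) =
        3 - 6 * (n ⬝ᵥ E₀ *ᵥ n) + 2 * E₀.trace + ∑ i, ∑ j, (E₀ i j) ^ 2 := by
      simp only [hB]
      ring
    rw [← hB0]
    exact hcont.tendsto.mono_left hl
  have htrace : Tendsto (fun p : ℝ × Matrix (Fin 3) (Fin 3) ℝ => p.2.trace) l (𝓝 E₀.trace) := by
    have hcont : Continuous fun p : ℝ × Matrix (Fin 3) (Fin 3) ℝ => p.2.trace := by fun_prop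
    exact (hcont.tendsto (0, E₀)).mono_left hl
  have hS : Tendsto (fun p : ℝ × Matrix (Fin 3) (Fin 3) ℝ =>
      (p.2.trace ^ 2 - (p.2 * p.2).trace) / 2 + p.1 * p.2.det) l
      (𝓝 ((E₀.trace ^ 2 - ∑ i, ∑ j, (E₀ i j) ^ 2) / 2)) := by
    have hcont : Continuous fun p : ℝ × Matrix (Fin 3) (Fin 3) ℝ =>
        (p.2.trace ^ 2 - (p.2 * p.2).trace) / 2 + p.1 * p.2.det := by fun_prop
    have hsq : (E₀ * E₀).trace = ∑ i, ∑ j, (E₀ i j) ^ 2 := by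
      simp only [trace, diag_apply, mul_apply]
      refine Finset.sum_congr rfl fun i _ => Finset.sum_congr rfl fun j _ => ?_
      rw [hE₀.apply i j, sq]
    simpa [hsq] using (hcont.tendsto (0, E₀)).mono_left hl
  have hψl := hψ.comp hh_lim
  have hgl := hg.comp hh_lim
  have hε : ∀ᶠ p in l, 0 < p.1 :=
    (eventually_mem_nhdsWithin (a := (0 : ℝ)) (s := Set.Ioi 0)).prod_inl _
  have hdet : ∀ᶠ p in l, 0 < 1 + p.1 * c p := by
    filter_upwards [hh_lim.eventually_const_lt (show (-1 : ℝ) < 0 by norm_num)] with p hp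
    linarith
  have hexp : (fun p : ℝ × Matrix (Fin 3) (Fin 3) ℝ => qne μ Wvol n p.1 p.2) =ᶠ[l] fun p =>
      μ / 2 * (B p * (1 - 2 / 3 * (p.1 * c p) + ψ (p.1 * c p) * (p.1 * c p) ^ 2)
          - 2 * ((p.2.trace ^ 2 - (p.2 * p.2).trace) / 2 + p.1 * p.2.det)
          + 3 * ψ (p.1 * c p) * c p ^ 2
          + 2 * p.2.trace * (- (2 / 3) * c p + ψ (p.1 * c p) * c p * (p.1 * c p)))
        + g (p.1 * c p) * c p ^ 2 := by
    filter_upwards [hε, hdet] with p hp hpdet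
    have hdetc : (1 + p.1 • p.2).det = 1 + p.1 * c p := det_one_add_smul_fin_three _ _
    have htr : trace ((1 + p.1 • p.2)ᵀ * (Lne p.1 n)⁻¹ * (1 + p.1 • p.2)) =
        3 + 2 * p.2.trace * p.1 + p.1 ^ 2 * B p := trace_Lne_inv (by positivity) hn _
    rw [qne, htr, hdetc, hgW, div_eq_mul_inv _ ((1 + p.1 * c p) ^ _),
      ← Real.rpow_neg hpdet.le, hψr]
    have hcS : c p = p.2.trace +
      p.1 * ((p.2.trace ^ 2 - (p.2 * p.2).trace) / 2 + p.1 * p.2.det) := by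
      simp only [hc]
      ring
    generalize (p.2.trace ^ 2 - (p.2 * p.2).trace) / 2 + p.1 * p.2.det = S at hcS ⊢
    generalize ψ (p.1 * c p) = r
    generalize g (p.1 * c p) = w
    generalize B p = b
    field_simp
    rw [hcS]
    ring
  refine Tendsto.congr' hexp.symm ?_
  have hlim := (((hB_lim.mul (((hh_lim.const_mul (2 / 3)).const_sub 1).add
      (hψl.mul (hh_lim.pow 2)))).sub (hS.const_mul 2)).add
      ((hψl.const_mul 3).mul (hc_lim.pow 2))).add
      ((htrace.const_mul 2).mul ((hc_lim.const_mul (-(2 / 3))).add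
        ((hψl.mul hc_lim).mul hh_lim)))
  rw [Vn_eq μ _ hn]
  refine ((hlim.const_mul (μ / 2)).add (hgl.mul (hc_lim.pow 2))).mono_right
    (le_of_eq (congrArg 𝓝 ?_))
  ring

lemma continuous_Vn (μ w : ℝ) {n : Fin 3 → ℝ} (hn : ∑ i, (n i) ^ 2 = 1) :
    Continuous (Vn μ w n) := by
  rw [funext (Vn_eq μ w hn)]
  fun_prop

/-- for every unit vector `n`, `q_{n,ε} → V_n` as `ε → 0⁺`, uniformly on
every compact subset of the `3×3` real symmetric matrices. -/
theorem qne_tendsto_Vn (μ : ℝ) (hμ : 0 < μ) (Wvol : ℝ → ℝ) (hW : WvolHyp Wvol)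
    (n : Fin 3 → ℝ) (hn : ∑ i, (n i) ^ 2 = 1)
    (K : Set (Matrix (Fin 3) (Fin 3) ℝ)) (hK : IsCompact K)
    (hKsym : ∀ E ∈ K, E.IsSymm) :
    TendstoUniformlyOn (fun ε E => qne μ Wvol n ε E)
      (Vn μ (deriv (deriv Wvol) 1) n) (𝓝[>] (0 : ℝ)) K := by
  rw [← tendstoLocallyUniformlyOn_iff_tendstoUniformlyOn_of_compact hK,
    tendstoLocallyUniformlyOn_iff_forall_tendsto]
  intro E₀ hE₀
  have hV := ((continuous_Vn μ (deriv (deriv Wvol) 1) hn).tendsto E₀).comp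
    (tendsto_snd (f := 𝓝[>] (0 : ℝ)) (g := 𝓝 E₀))
  have h := (hV.prodMk (tendsto_qne (μ := μ) hW hn (hKsym E₀ hE₀)))
  rw [← nhds_prod_eq] at h
  exact (h.mono_right (nhds_le_uniformity _)).mono_left
    (Filter.prod_mono le_rfl nhdsWithin_le_nhds)
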